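/- For each θ ∈ 𝔽₄ with θ² + θ + 1 = 0, there exists an 𝔽₁₆-rational point of the cubic surface S₃(θ) lying on no line of the surface: there is a nonzero vector v ∈ 𝔽₁₆⁴ with f₃(v) = 0 such that, letting K be an algebraic closure of 𝔽₁₆ and viewing v in K⁴, no 2-dimensional K-linear subspace of K⁴ on which f₃ vanishes identically contains v. -/

import Mathlib

open MvPolynomial

/-- The cubic form `X³ + Y³ + Z³ + θW³` with the variables `X, Y, Z, W` indexed by
`0, 1, 2, 3`, over any commutative ring `K` containing the coefficient `θ`. -/
noncomputable def f₃ (K : Type*) [CommRing K] (θ : K) : MvPolynomial (Fin 4) K :=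
  X 0 ^ 3 + X 1 ^ 3 + X 2 ^ 3 + C θ * X 3 ^ 3

theorem eval_f₃ {K : Type*} [CommRing K] (θ : K) (v : Fin 4 → K) :
    eval v (f₃ K θ) = v 0 ^ 3 + v 1 ^ 3 + v 2 ^ 3 + θ * v 3 ^ 3 := by
  simp [f₃]

/-- Over a field with 16 elements, every primitive cube root of unity `θ` is the trace
`ζ + ζ⁻¹` of a fifth root of unity `ζ`. -/
theorem exists_root_of_card_eq_sixteen {F : Type*} [Field F] [CharP F 2] (hF : Nat.card F = 16)
    {θ : F} (hθ : θ ^ 2 + θ + 1 = 0) : ∃ ζ : F, ζ ^ 2 + θ * ζ + 1 = 0 := by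
  have : Finite F := Nat.finite_of_card_ne_zero (by omega)
  have hc : Nat.card Fˣ = 15 := by rw [Nat.card_units, hF]
  have : Fact (Nat.Prime 5) := ⟨by norm_num⟩
  obtain ⟨u, hu⟩ := exists_prime_orderOf_dvd_card' (G := Fˣ) 5 (by rw [hc]; norm_num)
  have hu5 : (u : F) ^ 5 = 1 := by
    rw [← Units.val_pow_eq_pow_val, ← hu, pow_orderOf_eq_one, Units.val_one]
  have hu1 : (u : F) - 1 ≠ 0 := by
    intro h
    have : u = 1 := Units.ext (by simpa using sub_eq_zero.mp h)
    simp [this] at hu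
  have hprod : ((u : F) - 1) *
      (((u : F) ^ 2 + θ * u + 1) * ((u : F) ^ 2 + θ ^ 2 * u + 1)) = 0 := by
    grind
  rcases mul_eq_zero.mp ((mul_eq_zero.mp hprod).resolve_left hu1) with h | h
  · exact ⟨u, h⟩
  · exact ⟨(u : F) ^ 2, by grind⟩

/-- In characteristic 2, a point `(x, y, 0, w)` of the surface `f₃ = 0` with `x`, `y` nonzero
and `x³ ≠ y³` lies on no line of the surface. -/
theorem not_mem_of_forall_eval_f₃_eq_zero {K : Type*} [Field K] [CharP K 2] {θ : K}
    (hθ : θ ^ 2 + θ + 1 = 0) {v : Fin 4 → K} (hx : v 0 ≠ 0) (hy : v 1 ≠ 0)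
    (hxy : v 0 ^ 3 ≠ v 1 ^ 3) (hz : v 2 = 0) {W : Submodule K (Fin 4 → K)}
    (hW : Module.finrank K W = 2) (hf : ∀ w ∈ W, eval w (f₃ K θ) = 0) : v ∉ W := by
  intro hv
  obtain ⟨⟨w, hw⟩, hker, hne⟩ := (Submodule.ne_bot_iff _).mp
    (LinearMap.ker_ne_bot_of_finrank_lt
      (f := (LinearMap.proj (R := K) (φ := fun _ : Fin 4 => K) 3).comp W.subtype) (by simp [hW]))
  have hw3 : w 3 = 0 := by simpa using hker
  have e0 := hf v hv
  have e1 := hf w hw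
  have e2 := hf (v + w) (W.add_mem hv hw)
  have e3 := hf (v + θ • w) (W.add_mem hv (W.smul_mem θ hw))
  simp only [eval_f₃, Pi.add_apply, Pi.smul_apply, smul_eq_mul, hw3, hz] at e0 e1 e2 e3
  have hA : v 0 ^ 2 * w 0 + v 1 ^ 2 * w 1 = 0 := by grind
  have hB : v 0 * w 0 ^ 2 + v 1 * w 1 ^ 2 = 0 := by grind
  have hq : v 0 * v 1 * (v 0 ^ 3 - v 1 ^ 3) * w 1 ^ 2 = 0 := by grind
  have hw1 : w 1 = 0 := by simpa [hx, hy, sub_ne_zero.mpr hxy] using hq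
  have hw0 : w 0 = 0 := by simpa [hx, hw1] using hA
  have hw2 : w 2 = 0 := by simpa [hw0, hw1] using e1
  apply hne
  ext i
  fin_cases i <;> simp [hw0, hw1, hw2, hw3]

/-- For each `θ ∈ 𝔽₄` with `θ² + θ + 1 = 0`, there exists an `𝔽₁₆`-rational point of the
cubic surface `S₃(θ)` lying on no line of the surface (over an algebraic closure of `𝔽₁₆`),
where `𝔽₁₆` is equipped with an embedding `ι : 𝔽₄ → 𝔽₁₆`. -/
theorem S₃_exists_F16_point_off_lines (θ : GaloisField 2 2) (hθ : θ ^ 2 + θ + 1 = 0)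
    (ι : GaloisField 2 2 →+* GaloisField 2 4) :
    ∃ v : Fin 4 → GaloisField 2 4, v ≠ 0 ∧ eval v (f₃ (GaloisField 2 4) (ι θ)) = 0
      ∧ ∀ W : Submodule (AlgebraicClosure (GaloisField 2 4))
            (Fin 4 → AlgebraicClosure (GaloisField 2 4)),
          Module.finrank (AlgebraicClosure (GaloisField 2 4)) W = 2 →
          (∀ w ∈ W, eval w (f₃ (AlgebraicClosure (GaloisField 2 4))
            (algebraMap (GaloisField 2 4) (AlgebraicClosure (GaloisField 2 4)) (ι θ))) = 0) →
          (fun i => algebraMap (GaloisField 2 4) (AlgebraicClosure (GaloisField 2 4)) (v i))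
            ∉ W := by
  have : CharP (AlgebraicClosure (GaloisField 2 4)) 2 :=
    charP_of_injective_algebraMap' (GaloisField 2 4) 2
  have hι : ι θ ^ 2 + ι θ + 1 = 0 := by simpa using congrArg ι hθ
  obtain ⟨ζ, hζ⟩ := exists_root_of_card_eq_sixteen
    (by rw [GaloisField.card 2 4 (by norm_num)]; norm_num) hι
  have hζ0 : ζ ≠ 0 := by rintro rfl; simp at hζ
  have hsum : (ζ ^ 2) ^ 3 + (ζ ^ 3) ^ 3 = ι θ := by grind
  have hne : (ζ ^ 2) ^ 3 ≠ (ζ ^ 3) ^ 3 := by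
    intro h
    have h0 : ι θ = 0 := by rw [← hsum, h, CharTwo.add_self_eq_zero]
    simp [h0] at hι
  refine ⟨![ζ ^ 2, ζ ^ 3, 0, 1], fun h => one_ne_zero (congrFun h 3), ?_, fun W hW hf => ?_⟩
  · simp [eval_f₃, hsum, CharTwo.add_self_eq_zero]
  · refine not_mem_of_forall_eval_f₃_eq_zero ?_ ?_ ?_ ?_ ?_ hW hf
    · simpa using congrArg (algebraMap _ (AlgebraicClosure (GaloisField 2 4))) hι
    · simpa using hζ0
    · simpa using hζ0
    · simpa only [Matrix.cons_val_zero, Matrix.cons_val_one, ← map_pow] using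
        (algebraMap _ (AlgebraicClosure (GaloisField 2 4))).injective.ne hne
    · simp
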